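/- arXiv:1503.06607 — 2 statements merged into one kernel-verified Lean document; each statement's English description precedes it below -/
import Mathlib

section
/- For every (x,y) ∈ D(π/4), Φ(x,y) = sup{ ‖∇P_{a,b,c}(x,y)‖₂² : (a,b,c) ∈ ℝ³, ‖(a,b,c)‖ ≤ 1 }; that is, Φ is the optimal (smallest) pointwise Bernstein factor for the squared gradient length. -/
open Real Set

noncomputable section

/-- The sector D(π/4): points (x,y) with 0 ≤ y ≤ x and x² + y² ≤ 1. -/
def sector : Set (ℝ × ℝ) := {p | 0 ≤ p.2 ∧ p.2 ≤ p.1 ∧ p.1 ^ 2 + p.2 ^ 2 ≤ 1}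

/-- The supremum norm of the 2-homogeneous polynomial a·x² + b·y² + c·x·y over the sector. -/
def secNorm (a b c : ℝ) : ℝ :=
  sSup ((fun p : ℝ × ℝ => |a * p.1 ^ 2 + b * p.2 ^ 2 + c * p.1 * p.2|) '' sector)

/-- The optimal Bernstein factor Φ for the squared Euclidean gradient length. -/
def Phi (x y : ℝ) : ℝ :=
  if (0 ≤ y ∧ y ≤ (Real.sqrt 2 - 1) / 2 * x) ∨ ((4 * Real.sqrt 2 - 5) * x ≤ y ∧ y ≤ x) then
    4 * ((13 + 8 * Real.sqrt 2) * x ^ 2 + (69 + 48 * Real.sqrt 2) * y ^ 2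
      - 2 * (28 + 20 * Real.sqrt 2) * x * y)
  else if y ≤ (Real.sqrt 2 - 1) * x then
    x ^ 4 / y ^ 2 + 4 * (x ^ 2 + y ^ 2)
  else
    (3 * x ^ 2 - 2 * x * y + 3 * y ^ 2) ^ 2 / (2 * (x - y) ^ 2)

/-- The form `a·x² + b·y² + c·x·y` is bounded by `x² + y²` on the cone `0 ≤ y ≤ x`. -/
def ConeBounded (a b c : ℝ) : Prop :=
  ∀ x y : ℝ, 0 ≤ y → y ≤ x → |a * x ^ 2 + b * y ^ 2 + c * x * y| ≤ x ^ 2 + y ^ 2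

/-- The squared gradient lengths at `(x, y)` of the forms bounded on the cone. -/
def gradSqSet (x y : ℝ) : Set ℝ :=
  {r : ℝ | ∃ a b c : ℝ, ConeBounded a b c ∧
    r = (2 * a * x + c * y) ^ 2 + (2 * b * y + c * x) ^ 2}

theorem bddAbove_abs_form_sector (a b c : ℝ) :
    BddAbove ((fun p : ℝ × ℝ => |a * p.1 ^ 2 + b * p.2 ^ 2 + c * p.1 * p.2|) '' sector) := by
  refine ⟨|a| + |b| + |c|, ?_⟩
  rintro _ ⟨⟨x, y⟩, ⟨hy, hyx, hr⟩, rfl⟩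
  simp only at hy hyx hr ⊢
  have hx2 : x ^ 2 ≤ 1 := by nlinarith [sq_nonneg y]
  have hy2 : y ^ 2 ≤ 1 := by nlinarith [sq_nonneg x]
  have hxy : x * y ≤ 1 := by nlinarith [sq_nonneg (x - y)]
  have hxy0 : 0 ≤ x * y := mul_nonneg (hy.trans hyx) hy
  calc |a * x ^ 2 + b * y ^ 2 + c * x * y|
      ≤ |a * x ^ 2| + |b * y ^ 2| + |c * (x * y)| := by
        rw [← mul_assoc]; exact abs_add_three _ _ _
    _ = |a| * x ^ 2 + |b| * y ^ 2 + |c| * (x * y) := by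
        rw [abs_mul, abs_mul, abs_mul, abs_of_nonneg (sq_nonneg x), abs_of_nonneg (sq_nonneg y),
          abs_of_nonneg hxy0]
    _ ≤ |a| + |b| + |c| := by
        nlinarith [mul_nonneg (abs_nonneg a) (sub_nonneg.2 hx2),
          mul_nonneg (abs_nonneg b) (sub_nonneg.2 hy2), mul_nonneg (abs_nonneg c) (sub_nonneg.2 hxy)]

theorem secNorm_le_one_iff (a b c : ℝ) : secNorm a b c ≤ 1 ↔ ConeBounded a b c := by
  constructor
  · intro h x y hy hyx
    rcases (add_nonneg (sq_nonneg x) (sq_nonneg y)).eq_or_lt with h0 | h0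
    · have hx : x = 0 := by nlinarith [sq_nonneg x, sq_nonneg y]
      have hy' : y = 0 := by nlinarith [sq_nonneg x, sq_nonneg y]
      simp [hx, hy']
    · set r := √(x ^ 2 + y ^ 2) with hr
      have hr0 : 0 < r := Real.sqrt_pos.2 h0
      have hr2 : r ^ 2 = x ^ 2 + y ^ 2 := Real.sq_sqrt h0.le
      have hmem : (x / r, y / r) ∈ sector := by
        refine ⟨div_nonneg hy hr0.le, div_le_div_of_nonneg_right hyx hr0.le, ?_⟩
        simp only
        rw [div_pow, div_pow, ← add_div, hr2, div_self h0.ne']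
      have hle := (le_csSup (bddAbove_abs_form_sector a b c) (mem_image_of_mem _ hmem)).trans h
      simp only at hle
      have he : a * (x / r) ^ 2 + b * (y / r) ^ 2 + c * (x / r) * (y / r) =
          (a * x ^ 2 + b * y ^ 2 + c * x * y) / r ^ 2 := by
        field_simp
      rw [he, hr2, abs_div, abs_of_pos h0, div_le_one h0] at hle
      exact hle
  · intro h
    refine csSup_le (Set.Nonempty.image _ ⟨(0, 0), by simp [sector]⟩) ?_
    rintro _ ⟨⟨x, y⟩, ⟨hy, hyx, hr⟩, rfl⟩
    exact (h x y hy hyx).trans hr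

theorem copositive_offdiag_ge {α ω σ : ℝ}
    (h : ∀ s t : ℝ, 0 ≤ s → 0 ≤ t → 0 ≤ α * s ^ 2 + 2 * ω * s * t + σ * t ^ 2) :
    0 ≤ α ∧ 0 ≤ σ ∧ -(√α * √σ) ≤ ω := by
  have hα : 0 ≤ α := by simpa using h 1 0 zero_le_one le_rfl
  have hσ : 0 ≤ σ := by simpa using h 0 1 le_rfl zero_le_one
  refine ⟨hα, hσ, ?_⟩
  by_contra! hlt
  have hpq : 0 ≤ √α * √σ := by positivity
  have hω : ω < 0 := by linarith
  have h1 := h (√σ) (√α) (Real.sqrt_nonneg _) (Real.sqrt_nonneg _)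
  rw [Real.sq_sqrt hα, Real.sq_sqrt hσ] at h1
  have hsα := Real.sq_sqrt hα
  have hsσ := Real.sq_sqrt hσ
  have h2 : 0 ≤ (√α * √σ) * (√α * √σ + ω) := by
    have : α * σ = √α ^ 2 * √σ ^ 2 := by rw [hsα, hsσ]
    nlinarith
  have h3 : √α * √σ = 0 := by nlinarith
  rcases mul_eq_zero.1 h3 with h4 | h4
  · have hα0 : α = 0 := by rw [← hsα, h4]; ring
    have h5 := h ((σ + 1) / (-ω)) 1 (div_nonneg (by linarith) (by linarith)) zero_le_one
    have h6 : ω * ((σ + 1) / (-ω)) = -(σ + 1) := by field_simp [hω.ne]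
    rw [hα0] at h5
    nlinarith
  · have hσ0 : σ = 0 := by rw [← hsσ, h4]; ring
    have h5 := h 1 ((α + 1) / (-ω)) zero_le_one (div_nonneg (by linarith) (by linarith))
    have h6 : ω * ((α + 1) / (-ω)) = -(α + 1) := by field_simp [hω.ne]
    rw [hσ0] at h5
    nlinarith

theorem quadratic_le_of_endpoints {e f g l h z B : ℝ} (hg : 0 ≤ g) (hl : l ≤ z) (hh : z ≤ h)
    (hBl : e + f * l + g * l ^ 2 ≤ B) (hBh : e + f * h + g * h ^ 2 ≤ B) :
    e + f * z + g * z ^ 2 ≤ B := by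
  rcases (hl.trans hh).eq_or_lt with rfl | hlt
  · obtain rfl : z = l := le_antisymm hh hl
    exact hBl
  · have key : (h - l) * (B - (e + f * z + g * z ^ 2)) =
        (h - z) * (B - (e + f * l + g * l ^ 2)) + (z - l) * (B - (e + f * h + g * h ^ 2)) +
          g * ((h - l) * ((z - l) * (h - z))) := by ring
    have h0 : 0 ≤ (h - l) * (B - (e + f * z + g * z ^ 2)) := by
      rw [key]
      have h1 := sub_nonneg.2 hl
      have h2 := sub_nonneg.2 hh
      have h3 := sub_nonneg.2 hBl
      have h4 := sub_nonneg.2 hBh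
      have h5 := sub_nonneg.2 hlt.le
      positivity
    linarith [nonneg_of_mul_nonneg_right h0 (sub_pos.2 hlt)]

theorem rankOne_bound {x y k p q : ℝ} (hy : 0 ≤ y)
    (hp : 0 ≤ p) (hp2 : p ≤ √2) (hq : 0 ≤ q) (hq2 : q ≤ 2)
    (h₁ : ∀ m, 0 ≤ m → m ≤ 2 + √2 → m * (√2 * x - m * y) ≤ k)
    (h₂ : ∀ p, 0 ≤ p → √2 * (p + 1) * (2 * y - p * (x - y)) ≤ k) (hyx : y ≤ x) :
    (p * x - (p + q) * y) ^ 2 * (p ^ 2 + (p + q) ^ 2 - 2) ≤ k ^ 2 := by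
  have hw : √2 ^ 2 = 2 := Real.sq_sqrt zero_le_two
  have hw0 : 0 ≤ √2 := Real.sqrt_nonneg 2
  rcases le_total 0 (p * x - (p + q) * y) with hA | hA
  · have hA' : p * x - (p + q) * y ≤ √2 * x - (p + q) * y := by nlinarith
    have hk := h₁ (p + q) (by linarith) (by linarith)
    calc (p * x - (p + q) * y) ^ 2 * (p ^ 2 + (p + q) ^ 2 - 2)
        ≤ (p * x - (p + q) * y) ^ 2 * (p + q) ^ 2 :=
          mul_le_mul_of_nonneg_left (by nlinarith) (sq_nonneg _)
      _ ≤ (√2 * x - (p + q) * y) ^ 2 * (p + q) ^ 2 := by gcongr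
      _ = ((p + q) * (√2 * x - (p + q) * y)) ^ 2 := by ring
      _ ≤ k ^ 2 := pow_le_pow_left₀ (mul_nonneg (by linarith) (hA.trans hA')) hk 2
  · have hB : 0 ≤ (p + q) * y - p * x := by linarith
    have hB' : (p + q) * y - p * x ≤ 2 * y - p * (x - y) := by nlinarith
    have hk := h₂ p hp
    calc (p * x - (p + q) * y) ^ 2 * (p ^ 2 + (p + q) ^ 2 - 2)
        = ((p + q) * y - p * x) ^ 2 * (p ^ 2 + (p + q) ^ 2 - 2) := by ring
      _ ≤ ((p + q) * y - p * x) ^ 2 * (2 * (p + 1) ^ 2) :=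
          mul_le_mul_of_nonneg_left (by nlinarith) (sq_nonneg _)
      _ ≤ (2 * y - p * (x - y)) ^ 2 * (2 * (p + 1) ^ 2) := by gcongr
      _ = (√2 * (p + 1) * (2 * y - p * (x - y))) ^ 2 := by
          rw [mul_pow, mul_pow, hw]; ring
      _ ≤ k ^ 2 := pow_le_pow_left₀
          (mul_nonneg (mul_nonneg hw0 (by linarith)) (hB.trans hB')) hk 2

theorem gradSq_le_of_coneBounded {a b c x y k : ℝ} (h : ConeBounded a b c)
    (hy : 0 ≤ y) (hyx : y ≤ x)
    (h₁ : ∀ m, 0 ≤ m → m ≤ 2 + √2 → m * (√2 * x - m * y) ≤ k)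
    (h₂ : ∀ p, 0 ≤ p → √2 * (p + 1) * (2 * y - p * (x - y)) ≤ k) :
    (2 * a * x + c * y) ^ 2 + (2 * b * y + c * x) ^ 2 ≤ 4 * (x ^ 2 + y ^ 2 + k ^ 2) := by
  obtain ⟨α, hα⟩ : ∃ α, α = a + 1 := ⟨_, rfl⟩
  obtain ⟨σ, hσ⟩ : ∃ σ, σ = a + b + c + 2 := ⟨_, rfl⟩
  obtain ⟨ω, hω⟩ : ∃ ω, ω = a + 1 + c / 2 := ⟨_, rfl⟩
  obtain ⟨hα0, hσ0, hlow⟩ := copositive_offdiag_ge (α := α) (ω := ω) (σ := σ) (by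
    intro s t hs ht
    have := (abs_le.1 (h (s + t) t ht (by linarith))).1
    subst hα hσ hω
    nlinarith)
  obtain ⟨hα2, hσ4, hhigh⟩ := copositive_offdiag_ge (α := 2 - α) (ω := 2 - ω) (σ := 4 - σ) (by
    intro s t hs ht
    have := (abs_le.1 (h (s + t) t ht (by linarith))).2
    subst hα hσ hω
    nlinarith)
  have hsqrt4 : √(4 : ℝ) = 2 := by
    rw [show (4 : ℝ) = 2 ^ 2 by norm_num]; exact Real.sqrt_sq zero_le_two
  have hB₁ := rankOne_bound hy (Real.sqrt_nonneg α) (Real.sqrt_le_sqrt (by linarith))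
    (Real.sqrt_nonneg σ) ((Real.sqrt_le_sqrt (by linarith)).trans hsqrt4.le) h₁ h₂ hyx
  have hB₂ := rankOne_bound hy (Real.sqrt_nonneg (2 - α)) (Real.sqrt_le_sqrt (by linarith))
    (Real.sqrt_nonneg (4 - σ)) ((Real.sqrt_le_sqrt (by linarith)).trans hsqrt4.le) h₁ h₂ hyx
  have e₁ := Real.sq_sqrt hα0
  have e₂ := Real.sq_sqrt hσ0
  have e₃ := Real.sq_sqrt hα2
  have e₄ := Real.sq_sqrt hσ4
  have ha : a = α - 1 := by linarith
  have hc : c = 2 * (ω - α) := by linarith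
  have hb : b = σ + α - 2 * ω - 1 := by linarith
  generalize √α = p at *
  generalize √σ = q at *
  generalize √(2 - α) = p' at *
  generalize √(4 - σ) = q' at *
  have hquad := quadratic_le_of_endpoints
    (e := ((α - 1) * x - α * y) ^ 2 + ((σ + α - 1) * y - α * x) ^ 2)
    (f := 2 * ((α - 1) * x - α * y) * y + 2 * ((σ + α - 1) * y - α * x) * (x - 2 * y))
    (g := y ^ 2 + (x - 2 * y) ^ 2) (l := -(p * q)) (h := 2 + p' * q') (z := ω)
    (B := x ^ 2 + y ^ 2 + k ^ 2) (by positivity) hlow (by linarith)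
    (by rw [← e₁, ← e₂]; linear_combination hB₁)
    (by
      rw [show α = 2 - p' ^ 2 by linarith, show σ = 4 - q' ^ 2 by linarith]
      linear_combination hB₂)
  rw [ha, hb, hc]
  linear_combination 4 * hquad

theorem coneBounded_rankOne {u : ℝ} (hu : 0 ≤ u) (hu2 : u ≤ 1 + √2) :
    ConeBounded 1 (2 * u ^ 2 - 1) (-4 * u) := by
  intro x y hy hyx
  have hw : √2 ^ 2 = 2 := Real.sq_sqrt zero_le_two
  have hw1 : 1 ≤ √2 := Real.one_le_sqrt.2 one_le_two
  have hu1 : (u - 1) ^ 2 ≤ 2 := by nlinarith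
  rw [abs_le]
  constructor
  · nlinarith [sq_nonneg (x - u * y)]
  · nlinarith [mul_nonneg (mul_nonneg hu hy) (sub_nonneg.2 hyx),
      mul_nonneg (sq_nonneg y) (sub_nonneg.2 hu1)]

theorem isGreatest_gradSqSet_rankOne {x y u : ℝ} (hy : 0 ≤ y) (hyx : y ≤ x)
    (hu : 0 ≤ u) (hu2 : u ≤ 1 + √2)
    (h₁ : ∀ m, 0 ≤ m → m ≤ 2 + √2 → m * (√2 * x - m * y) ≤ 2 * u * (x - u * y))
    (h₂ : ∀ p, 0 ≤ p → √2 * (p + 1) * (2 * y - p * (x - y)) ≤ 2 * u * (x - u * y)) :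
    IsGreatest (gradSqSet x y) (4 * (x ^ 2 + y ^ 2 + (2 * u * (x - u * y)) ^ 2)) := by
  refine ⟨⟨1, 2 * u ^ 2 - 1, -4 * u, coneBounded_rankOne hu hu2, by ring⟩, ?_⟩
  rintro _ ⟨a, b, c, h, rfl⟩
  exact gradSq_le_of_coneBounded h hy hyx h₁ h₂

theorem isGreatest_gradSqSet_of_le {x y : ℝ} (hy : 0 ≤ y) (hyx : y ≤ (√2 - 1) * x) :
    IsGreatest (gradSqSet x y) (Phi x y) := by
  have hw : √2 ^ 2 = 2 := Real.sq_sqrt zero_le_two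
  have hw1 : (1.41 : ℝ) < √2 := Real.lt_sqrt_of_sq_lt (by norm_num)
  have hw2 : √2 < (1.415 : ℝ) := (Real.sqrt_lt' (by norm_num)).2 (by norm_num)
  set w := √2
  have hx : 0 ≤ x := by nlinarith
  have hyx' : y ≤ x := by nlinarith
  rcases le_or_gt y ((w - 1) / 2 * x) with h | h
  · have hPhi : Phi x y =
        4 * (x ^ 2 + y ^ 2 + (2 * (1 + w) * (x - (1 + w) * y)) ^ 2) := by
      rw [Phi, if_pos (Or.inl ⟨hy, h⟩)]
      change 4 * ((13 + 8 * w) * x ^ 2 + (69 + 48 * w) * y ^ 2 - 2 * (28 + 20 * w) * x * y) = _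
      linear_combination
        -16 * (x ^ 2 - 2 * (w + 3) * x * y + (w ^ 2 + 4 * w + 8) * y ^ 2) * hw
    rw [hPhi]
    have hMy : (2 + w) * y ≤ w / 2 * x := by
      nlinarith [mul_le_mul_of_nonneg_left h (by linarith : (0 : ℝ) ≤ 2 + w)]
    have hk : 2 * (1 + w) * (x - (1 + w) * y) = (2 + w) * (w * x - (2 + w) * y) := by
      linear_combination (-x - y) * hw
    refine isGreatest_gradSqSet_rankOne hy hyx' (by linarith) le_rfl ?_ ?_
    · intro m hm hm2
      rw [hk]
      have : 0 ≤ (2 + w - m) * (w * x - (2 + w + m) * y) :=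
        mul_nonneg (by linarith) (by nlinarith)
      nlinarith
    · intro p hp
      rw [hk]
      have hz : 2 * y ≤ x - y := by nlinarith
      have h3 : (p + 1) * (2 * y - p * (x - y)) ≤ 2 * y := by
        nlinarith [mul_nonneg hp (sub_nonneg.2 hz), mul_nonneg (sq_nonneg p) (sub_nonneg.2 hyx')]
      have h4 : w * ((p + 1) * (2 * y - p * (x - y))) ≤ w * (2 * y) :=
        mul_le_mul_of_nonneg_left h3 (by linarith)
      have h5 : (2 + w) * (w / 2 * x) ≤ (2 + w) * (w * x - (2 + w) * y) :=
        mul_le_mul_of_nonneg_left (by linarith) (by linarith)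
      nlinarith
  · have hx0 : 0 < x := by
      rcases hx.eq_or_lt with rfl | h0
      · linarith
      · exact h0
    have hy0 : 0 < y := lt_of_le_of_lt (by nlinarith) h
    have hz : 0 < x - y := by nlinarith
    have hk : 2 * (x / (2 * y)) * (x - x / (2 * y) * y) = x ^ 2 / (2 * y) := by
      field_simp; ring
    have hPhi : Phi x y =
        4 * (x ^ 2 + y ^ 2 + (2 * (x / (2 * y)) * (x - x / (2 * y) * y)) ^ 2) := by
      rw [Phi, if_neg, if_pos hyx, hk]
      · field_simp; ring
      · rintro (⟨-, h'⟩ | ⟨h', -⟩)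
        · exact absurd h' (not_le.2 h)
        · change (4 * w - 5) * x ≤ y at h'
          nlinarith
    rw [hPhi]
    refine isGreatest_gradSqSet_rankOne hy hyx' (by positivity) ?_ ?_ ?_
    · change x / (2 * y) ≤ 1 + w
      rw [div_le_iff₀ (by positivity)]
      nlinarith [mul_le_mul_of_nonneg_left h.le (by linarith : (0 : ℝ) ≤ 1 + w)]
    · intro m _ _
      rw [hk, le_div_iff₀ (by positivity)]
      change m * (w * x - m * y) * (2 * y) ≤ x ^ 2
      have hsq : (x - w * m * y) ^ 2 = x ^ 2 - m * (w * x - m * y) * (2 * y) := by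
        linear_combination (m * y) ^ 2 * hw
      linarith [sq_nonneg (x - w * m * y)]
    · intro p hp
      rw [hk, le_div_iff₀ (by positivity)]
      change w * (p + 1) * (2 * y - p * (x - y)) * (2 * y) ≤ x ^ 2
      have h3 : 4 * (x - y) * ((p + 1) * (2 * y - p * (x - y))) ≤ (x + y) ^ 2 := by
        nlinarith [sq_nonneg (2 * y - (x - y) - 2 * p * (x - y))]
      have hyw : (1 + w) * y ≤ x := by
        nlinarith [mul_le_mul_of_nonneg_left hyx (by linarith : (0 : ℝ) ≤ 1 + w)]
      have h4 : w * y * (x + y) ^ 2 ≤ 2 * x ^ 2 * (x - y) := by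
        have h5 : x + y ≤ w * x := by linarith
        have h6 : (x + y) ^ 2 ≤ 2 * x ^ 2 := by
          calc (x + y) ^ 2 ≤ (w * x) ^ 2 := pow_le_pow_left₀ (by linarith) h5 2
            _ = 2 * x ^ 2 := by rw [mul_pow, hw]
        have h7 : w * y ≤ x - y := by linarith
        calc w * y * (x + y) ^ 2 ≤ (x - y) * (2 * x ^ 2) :=
              mul_le_mul h7 h6 (sq_nonneg _) hz.le
          _ = _ := by ring
      have h8 : (4 * (x - y)) * (w * (p + 1) * (2 * y - p * (x - y)) * (2 * y)) ≤
          (4 * (x - y)) * x ^ 2 := by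
        nlinarith [mul_le_mul_of_nonneg_left h3 (by positivity : 0 ≤ 2 * w * y)]
      exact le_of_mul_le_mul_left h8 (by linarith)

theorem ConeBounded.reflect {a b c : ℝ} (h : ConeBounded a b c) :
    ConeBounded ((a + b + c) / 2) ((a + b - c) / 2) (a - b) := by
  intro x y hy hyx
  have := h (x + y) (x - y) (by linarith) (by linarith)
  rw [abs_le] at this ⊢
  constructor <;> nlinarith [this.1, this.2]

theorem gradSqSet_reflect_subset (x y : ℝ) :
    gradSqSet x y ⊆ gradSqSet ((x + y) / √2) ((x - y) / √2) := by
  rintro _ ⟨a, b, c, h, rfl⟩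
  refine ⟨_, _, _, h.reflect, ?_⟩
  have hw : √2 ^ 2 = 2 := Real.sq_sqrt zero_le_two
  field_simp
  rw [hw]
  ring

theorem gradSqSet_reflect (x y : ℝ) :
    gradSqSet ((x + y) / √2) ((x - y) / √2) = gradSqSet x y := by
  refine (gradSqSet_reflect_subset x y).antisymm' ?_
  have h := gradSqSet_reflect_subset ((x + y) / √2) ((x - y) / √2)
  have hw : √2 * √2 = 2 := Real.mul_self_sqrt zero_le_two
  have e₁ : ((x + y) / √2 + (x - y) / √2) / √2 = x := by
    rw [← add_div, div_div, hw]; ring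
  have e₂ : ((x + y) / √2 - (x - y) / √2) / √2 = y := by
    rw [← sub_div, div_div, hw]; ring
  rwa [e₁, e₂] at h

theorem Phi_reflect {x y : ℝ} (hyx : y ≤ x) (h : (√2 - 1) * x < y) :
    Phi ((x + y) / √2) ((x - y) / √2) = Phi x y := by
  have hw : √2 ^ 2 = 2 := Real.sq_sqrt zero_le_two
  have hw1 : (1.41 : ℝ) < √2 := Real.lt_sqrt_of_sq_lt (by norm_num)
  have hw2 : √2 < (1.415 : ℝ) := (Real.sqrt_lt' (by norm_num)).2 (by norm_num)
  unfold Phi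
  set w := √2
  have hw0 : 0 < w := by linarith
  have hx : 0 < x := by nlinarith
  have hy : 0 < y := by nlinarith
  have e₁ : ∀ d : ℝ, (x - y) / w ≤ d * ((x + y) / w) ↔ x - y ≤ d * (x + y) := fun d => by
    rw [← mul_div_assoc, div_le_div_iff_of_pos_right hw0]
  have e₂ : ∀ d : ℝ, d * ((x + y) / w) ≤ (x - y) / w ↔ d * (x + y) ≤ x - y := fun d => by
    rw [← mul_div_assoc, div_le_div_iff_of_pos_right hw0]
  have hdiv : 0 ≤ (x - y) / w := div_nonneg (by linarith) hw0.le
  have hsq₁ : ((x + y) / w) ^ 2 = (x + y) ^ 2 / 2 := by rw [div_pow, hw]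
  have hsq₂ : ((x - y) / w) ^ 2 = (x - y) ^ 2 / 2 := by rw [div_pow, hw]
  have hmul : ((x + y) / w) * ((x - y) / w) = (x + y) * (x - y) / 2 := by
    rw [div_mul_div_comm, ← pow_two w, hw]
  rcases le_or_gt ((4 * w - 5) * x) y with h' | h'
  · have hr : x - y ≤ (w - 1) / 2 * (x + y) := by
      nlinarith [mul_le_mul_of_nonneg_left h' (by linarith : (0 : ℝ) ≤ (w + 1) / 2)]
    rw [if_pos (Or.inl ⟨hdiv, (e₁ _).2 hr⟩), if_pos (Or.inr ⟨h', hyx⟩), hsq₁, hsq₂,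
      mul_assoc (2 * (28 + 20 * w)), hmul]
    ring
  · have hlt : y < x := by nlinarith
    have hz : x - y ≠ 0 := by linarith
    have hr : x - y ≤ (w - 1) * (x + y) := by
      nlinarith [mul_le_mul_of_nonneg_left h.le hw0.le]
    rw [if_neg, if_pos ((e₁ _).2 hr), if_neg, if_neg (not_le.2 h)]
    · rw [show ((x + y) / w) ^ 4 = (((x + y) / w) ^ 2) ^ 2 by ring, hsq₁, hsq₂]
      field_simp
      ring
    · rintro (⟨-, h1⟩ | ⟨h1, -⟩)
      · nlinarith
      · linarith
    · rw [e₁, e₂]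
      rintro (⟨-, h1⟩ | ⟨h1, -⟩)
      · nlinarith [mul_lt_mul_of_pos_left h' (by linarith : (0 : ℝ) < (w + 1) / 2)]
      · nlinarith

theorem isGreatest_gradSqSet {x y : ℝ} (hy : 0 ≤ y) (hyx : y ≤ x) :
    IsGreatest (gradSqSet x y) (Phi x y) := by
  rcases le_or_gt y ((√2 - 1) * x) with h | h
  · exact isGreatest_gradSqSet_of_le hy h
  · have hw : √2 ^ 2 = 2 := Real.sq_sqrt zero_le_two
    have hw0 : 0 < √2 := Real.sqrt_pos.2 zero_lt_two
    rw [← gradSqSet_reflect, ← Phi_reflect hyx h]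
    refine isGreatest_gradSqSet_of_le (div_nonneg (by linarith) hw0.le) ?_
    rw [← mul_div_assoc, div_le_div_iff_of_pos_right hw0]
    nlinarith [mul_le_mul_of_nonneg_left h.le hw0.le]

theorem stmt_4 (x y : ℝ) (hxy : (x, y) ∈ sector) :
    Phi x y =
      sSup {r : ℝ | ∃ a b c : ℝ, secNorm a b c ≤ 1 ∧
        r = (2 * a * x + c * y) ^ 2 + (2 * b * y + c * x) ^ 2} := by
  simp only [secNorm_le_one_iff]
  exact (isGreatest_gradSqSet hxy.1 hxy.2.1).csSup_eq.symm
end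
end

section
/- For every (a,b,c) ∈ ℝ³ and every (x,y) ∈ D(π/4), ‖∇P_{a,b,c}(x,y)‖₂² ≤ 4·(13+8√2)·‖(a,b,c)‖². Moreover this Markov-type bound is sharp: for the triple (1, 5+4√2, −4−4√2) one has ‖(1, 5+4√2, −4−4√2)‖ = 1 and sup{ ‖∇P_{1,5+4√2,−4−4√2}(x,y)‖₂² : (x,y) ∈ D(π/4) } = 4·(13+8√2). -/
open Real Set

noncomputable section

theorem abs_le_secNorm (a b c : ℝ) {x y : ℝ} (h : (x, y) ∈ sector) :
    |a * x ^ 2 + b * y ^ 2 + c * x * y| ≤ secNorm a b c := by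
  refine le_csSup ⟨|a| + |b| + |c|, ?_⟩ ⟨(x, y), h, rfl⟩
  rintro _ ⟨⟨p, q⟩, ⟨hq, hqp, hpq⟩, rfl⟩
  dsimp only at hq hqp hpq ⊢
  have hp2 : p ^ 2 ≤ 1 := by nlinarith
  have hq2 : q ^ 2 ≤ 1 := by nlinarith
  have h_mul : p * q ≤ 1 := by nlinarith
  have h_nonneg : 0 ≤ p * q := mul_nonneg (hq.trans hqp) hq
  calc |a * p ^ 2 + b * q ^ 2 + c * p * q|
      ≤ |a * p ^ 2| + |b * q ^ 2| + |c * (p * q)| := by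
        rw [mul_assoc c]; exact abs_add_three _ _ _
    _ = |a| * p ^ 2 + |b| * q ^ 2 + |c| * (p * q) := by
        rw [abs_mul, abs_mul, abs_mul, abs_of_nonneg (sq_nonneg p), abs_of_nonneg (sq_nonneg q),
          abs_of_nonneg h_nonneg]
    _ ≤ |a| + |b| + |c| := by
        gcongr <;> exact mul_le_of_le_one_right (abs_nonneg _) (by assumption)

theorem abs_coeff_le_secNorm (a b c : ℝ) : |a| ≤ secNorm a b c := by
  simpa using abs_le_secNorm a b c (x := 1) (y := 0) (by simp [sector])

theorem abs_diagonal_le_secNorm (a b c : ℝ) : |(a + b + c) / 2| ≤ secNorm a b c := by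
  have h2 : √2 ^ 2 = 2 := Real.sq_sqrt (by norm_num)
  have h := abs_le_secNorm a b c (x := √2 / 2) (y := √2 / 2)
    ⟨by positivity, le_rfl, by dsimp only; nlinarith⟩
  convert h using 2
  linear_combination (-(a + b + c) / 4) * h2

/-- The value at the bisector point `(cos (π / 8), sin (π / 8))`. -/
theorem abs_bisector_le_secNorm (a b c : ℝ) :
    |(a * (2 + √2) + b * (2 - √2) + c * √2) / 4| ≤ secNorm a b c := by
  have hcos : cos (π / 8) ^ 2 = (2 + √2) / 4 := by
    rw [Real.cos_sq, show 2 * (π / 8) = π / 4 by ring, Real.cos_pi_div_four]; ring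
  have hsin : sin (π / 8) ^ 2 = (2 - √2) / 4 := by
    rw [Real.sin_sq, hcos]; ring
  have hmul : cos (π / 8) * sin (π / 8) = √2 / 4 := by
    have h := Real.sin_two_mul (π / 8)
    rw [show 2 * (π / 8) = π / 4 by ring, Real.sin_pi_div_four] at h
    linarith
  have hs : 0 ≤ sin (π / 8) :=
    Real.sin_nonneg_of_nonneg_of_le_pi (by positivity) (by linarith [Real.pi_pos])
  have hc : 0 ≤ cos (π / 8) :=
    Real.cos_nonneg_of_neg_pi_div_two_le_of_le (by linarith [Real.pi_pos])
      (by linarith [Real.pi_pos])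
  have hsc : sin (π / 8) ≤ cos (π / 8) :=
    (sq_le_sq₀ hs hc).1 (by rw [hsin, hcos]; linarith [Real.sqrt_nonneg 2])
  have h := abs_le_secNorm a b c (x := cos (π / 8)) (y := sin (π / 8))
    ⟨hs, hsc, (Real.cos_sq_add_sin_sq _).le⟩
  rw [hcos, hsin, mul_assoc c, hmul] at h
  convert h using 2
  ring

theorem secNorm_neg (a b c : ℝ) : secNorm (-a) (-b) (-c) = secNorm a b c := by
  unfold secNorm
  congr 2
  ext p
  rw [← abs_neg]
  congr 1
  ring

/-- The gradient bound, when the half-trace `(a + b) / 2` is nonnegative. -/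
theorem grad_sq_le_of_add_nonneg {a b c x y : ℝ} (hab : 0 ≤ a + b) (h : (x, y) ∈ sector) :
    (2 * a * x + c * y) ^ 2 + (2 * b * y + c * x) ^ 2 ≤
      4 * (13 + 8 * √2) * secNorm a b c ^ 2 := by
  have hP := (abs_le.1 (abs_le_secNorm a b c h)).2
  obtain ⟨hu₁, hu₂⟩ := abs_le.1 (abs_coeff_le_secNorm a b c)
  obtain ⟨hv₁, hv₂⟩ := abs_le.1 (abs_diagonal_le_secNorm a b c)
  obtain ⟨hw, -⟩ := abs_le.1 (abs_bisector_le_secNorm a b c)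
  have hr : x ^ 2 + y ^ 2 ≤ 1 := h.2.2
  generalize secNorm a b c = N at *
  have h2 : √2 ^ 2 = 2 := Real.sq_sqrt (by norm_num)
  have h_one : 1 ≤ √2 := Real.one_le_sqrt.2 (by norm_num)
  have h_two : √2 ≤ 3 / 2 := by nlinarith
  generalize √2 = s at *
  have hN : 0 ≤ N := by linarith
  have hlower : (2 - s) * ((a + b) / 2) - s * N ≤ a + (a + b + c) / 2 := by nlinarith
  have htrace : (a + b) / 2 ≤ (3 + 2 * s) * N := by
    have h1 : (2 - s) * ((a + b) / 2) ≤ (2 + s) * N := by linarith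
    nlinarith [mul_le_mul_of_nonneg_left h1 (by linarith : 0 ≤ 2 + s)]
  have hshift : (a + (a + b + c) / 2 - N - (a + b) / 2) ^ 2 ≤ ((2 + 2 * s) * N) ^ 2 := by
    refine sq_le_sq' ?_ ?_
    · nlinarith [mul_le_mul_of_nonneg_left htrace (by linarith : 0 ≤ s - 1)]
    · nlinarith
  have hdisc : c ^ 2 / 4 - a * b + (a + b) * N ≤ (13 + 8 * s) * N ^ 2 := by
    have hK : ((2 + 2 * s) * N) ^ 2 + N ^ 2 = (13 + 8 * s) * N ^ 2 := by
      linear_combination 4 * N ^ 2 * h2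
    nlinarith [mul_nonneg (sub_nonneg.2 hu₂) (sub_nonneg.2 hv₂)]
  have htrace' : (a + b) * N ≤ (13 + 8 * s) * N ^ 2 := by
    nlinarith [mul_le_mul_of_nonneg_right htrace hN, mul_nonneg (by linarith : 0 ≤ s) (sq_nonneg N)]
  have hgrad : (2 * a * x + c * y) ^ 2 + (2 * b * y + c * x) ^ 2 =
      4 * ((c ^ 2 / 4 - a * b) * (x ^ 2 + y ^ 2) +
        (a + b) * (a * x ^ 2 + b * y ^ 2 + c * x * y)) := by ring
  rw [hgrad]
  have hval := mul_le_mul_of_nonneg_left hP hab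
  rcases le_total 0 (c ^ 2 / 4 - a * b) with hQ | hQ
  · have := mul_le_of_le_one_right hQ hr
    linarith
  · have := mul_nonpos_of_nonpos_of_nonneg hQ (by positivity : 0 ≤ x ^ 2 + y ^ 2)
    linarith

theorem grad_sq_le (a b c : ℝ) {x y : ℝ} (h : (x, y) ∈ sector) :
    (2 * a * x + c * y) ^ 2 + (2 * b * y + c * x) ^ 2 ≤
      4 * (13 + 8 * √2) * secNorm a b c ^ 2 := by
  rcases le_total 0 (a + b) with hab | hab
  · exact grad_sq_le_of_add_nonneg hab h
  · have := grad_sq_le_of_add_nonneg (a := -a) (b := -b) (c := -c) (by linarith) h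
    rw [secNorm_neg] at this
    linarith

theorem secNorm_extremal : secNorm 1 (5 + 4 * √2) (-4 - 4 * √2) = 1 := by
  refine le_antisymm ?_ (by simpa using abs_coeff_le_secNorm 1 (5 + 4 * √2) (-4 - 4 * √2))
  refine csSup_le (Set.Nonempty.image _ ⟨(0, 0), by simp [sector]⟩) ?_
  rintro _ ⟨⟨x, y⟩, ⟨hy, hyx, hr⟩, rfl⟩
  dsimp only at hy hyx hr ⊢
  have h2 : √2 ^ 2 = 2 := Real.sq_sqrt (by norm_num)
  refine abs_le.2 ⟨?_, ?_⟩
  · have hsq : 2 * (x - (1 + √2) * y) ^ 2 =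
        1 * x ^ 2 + (5 + 4 * √2) * y ^ 2 + (-4 - 4 * √2) * x * y + (x ^ 2 + y ^ 2) := by
      linear_combination 2 * y ^ 2 * h2
    linarith [sq_nonneg (x - (1 + √2) * y)]
  · have := mul_nonneg (by positivity : 0 ≤ (4 + 4 * √2) * y) (sub_nonneg.2 hyx)
    linarith

theorem stmt_5 :
    (∀ a b c x y : ℝ, (x, y) ∈ sector →
      (2 * a * x + c * y) ^ 2 + (2 * b * y + c * x) ^ 2 ≤
        4 * (13 + 8 * Real.sqrt 2) * (secNorm a b c) ^ 2) ∧
    secNorm 1 (5 + 4 * Real.sqrt 2) (-4 - 4 * Real.sqrt 2) = 1 ∧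
    sSup ((fun p : ℝ × ℝ =>
        (2 * 1 * p.1 + (-4 - 4 * Real.sqrt 2) * p.2) ^ 2 +
        (2 * (5 + 4 * Real.sqrt 2) * p.2 + (-4 - 4 * Real.sqrt 2) * p.1) ^ 2) '' sector) =
      4 * (13 + 8 * Real.sqrt 2) := by
  refine ⟨fun a b c x y h => grad_sq_le a b c h, secNorm_extremal, ?_⟩
  refine IsGreatest.csSup_eq ⟨⟨(1, 0), by simp [sector], ?_⟩, ?_⟩
  · have h2 : √2 ^ 2 = 2 := Real.sq_sqrt (by norm_num)
    dsimp only
    linear_combination 16 * h2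
  · rintro _ ⟨⟨x, y⟩, h, rfl⟩
    simpa [secNorm_extremal] using grad_sq_le 1 (5 + 4 * √2) (-4 - 4 * √2) h
end
end
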